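/- arXiv:2405.19364 — 4 statements merged into one kernel-verified Lean document; each statement's English description precedes it below -/
import Mathlib

section
/- Let (ℕ₀, b, m) be a birth-death chain. Then the following are equivalent: (1) Σ_{k=0}^∞ (Σ_{r=0}^k 1/b(r,r+1))² · m(k+1) = ∞; (2) for every λ < 0, every function v ∈ ℓ²(ℕ₀,m) satisfying Δv(x) = λ·v(x) for all x ∈ ℕ₀ is identically zero. -/
/-- The formal Laplacian of a birth-death chain `(ℕ, b, m)` acting on `f : ℕ → ℝ`. -/
noncomputable def lap (b : ℕ → ℕ → ℝ) (m : ℕ → ℝ) (f : ℕ → ℝ) : ℕ → ℝ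
  | 0 => (1 / m 0) * (b 0 1 * (f 0 - f 1))
  | (x + 1) => (1 / m (x + 1)) *
      (b (x + 1) (x + 2) * (f (x + 1) - f (x + 2)) + b (x + 1) x * (f (x + 1) - f x))

/-- Green's formula for an eigenfunction: the flux out of `{0, …, x}` is the accumulated mass. -/
theorem lap_flux {b : ℕ → ℕ → ℝ} {m : ℕ → ℝ} (hsymm : ∀ x y, b x y = b y x)
    (hm : ∀ x, 0 < m x) {lam : ℝ} {u : ℕ → ℝ} (h : ∀ x, lap b m u x = lam * u x) (x : ℕ) :
    b x (x + 1) * (u (x + 1) - u x) = -lam * ∑ j ∈ Finset.range (x + 1), m j * u j := by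
  induction x with
  | zero =>
    have h0 := h 0
    have hm0 := (hm 0).ne'
    simp only [lap] at h0
    field_simp at h0
    simp only [zero_add, Finset.sum_range_one]
    linarith
  | succ x ih =>
    have h0 := h (x + 1)
    have hm0 := (hm (x + 1)).ne'
    simp only [lap] at h0
    rw [hsymm (x + 1) x] at h0
    field_simp at h0
    rw [Finset.sum_range_succ, mul_add, ← ih]
    linarith

/-- An eigenfunction to a negative eigenvalue with nonnegative initial value is nonnegative and
grows at least like the resistance from the root. -/
theorem lap_eigenfunction_lower_bound {b : ℕ → ℕ → ℝ} {m : ℕ → ℝ}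
    (hsymm : ∀ x y, b x y = b y x) (hb : ∀ x, 0 < b x (x + 1)) (hm : ∀ x, 0 < m x)
    {lam : ℝ} (hlam : lam < 0) {u : ℕ → ℝ} (h : ∀ x, lap b m u x = lam * u x)
    (h0 : 0 ≤ u 0) (x : ℕ) :
    0 ≤ u x ∧ -lam * (m 0 * u 0) * ∑ r ∈ Finset.range x, 1 / b r (r + 1) ≤ u x := by
  have step : ∀ x, (∀ y ≤ x, 0 ≤ u y) →
      -lam * (m 0 * u 0) * (1 / b x (x + 1)) ≤ u (x + 1) - u x := by
    intro x hx
    have hsum : m 0 * u 0 ≤ ∑ j ∈ Finset.range (x + 1), m j * u j :=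
      Finset.single_le_sum (f := fun j => m j * u j)
        (fun j hj => mul_nonneg (hm j).le (hx j (by simp at hj; omega))) (by simp)
    rw [mul_one_div, div_le_iff₀ (hb x), mul_comm (u (x + 1) - u x), lap_flux hsymm hm h x]
    exact mul_le_mul_of_nonneg_left hsum (by linarith)
  have hc : 0 ≤ -lam * (m 0 * u 0) :=
    mul_nonneg (by linarith) (mul_nonneg (hm 0).le h0)
  have nonneg : ∀ x, 0 ≤ u x := by
    intro x
    induction x using Nat.strong_induction_on with
    | _ x ih =>
      cases x with
      | zero => exact h0
      | succ x =>
        have h1 := step x (fun y hy => ih y (by omega))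
        have h2 := mul_nonneg hc (one_div_pos.2 (hb x)).le
        have h3 := ih x (by omega)
        linarith
  refine ⟨nonneg x, ?_⟩
  induction x with
  | zero => simpa using h0
  | succ x ih =>
    rw [Finset.sum_range_succ, mul_add]
    linarith [step x (fun y _ => nonneg y)]

/-- The solution of `Δv = -v` with `v 0 = 1`, paired with its flux. -/
noncomputable def eigenpair (b : ℕ → ℕ → ℝ) (m : ℕ → ℝ) : ℕ → ℝ × ℝ
  | 0 => (1, m 0)
  | n + 1 =>
    ((eigenpair b m n).1 + (eigenpair b m n).2 / b n (n + 1),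
      (eigenpair b m n).2 +
        m (n + 1) * ((eigenpair b m n).1 + (eigenpair b m n).2 / b n (n + 1)))

theorem lap_eigenpair {b : ℕ → ℕ → ℝ} {m : ℕ → ℝ} (hsymm : ∀ x y, b x y = b y x)
    (hb : ∀ x, 0 < b x (x + 1)) (hm : ∀ x, 0 < m x) (x : ℕ) :
    lap b m (fun n => (eigenpair b m n).1) x = -1 * (eigenpair b m x).1 := by
  cases x with
  | zero =>
    have := (hm 0).ne'
    have := (hb 0).ne'
    simp only [lap, eigenpair, zero_add] at *
    field_simp
    ring
  | succ x =>
    have := (hm (x + 1)).ne'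
    have := (hb x).ne'
    have := (hb (x + 1)).ne'
    have hs := hsymm (x + 1) x
    simp only [lap, eigenpair, hs, add_assoc, Nat.reduceAdd] at *
    field_simp
    ring

theorem eigenpair_pos {b : ℕ → ℕ → ℝ} {m : ℕ → ℝ}
    (hb : ∀ x, 0 < b x (x + 1)) (hm : ∀ x, 0 < m x) (x : ℕ) :
    0 < (eigenpair b m x).1 ∧ m 0 ≤ (eigenpair b m x).2 := by
  induction x with
  | zero => simp [eigenpair]
  | succ x ih =>
    have h1 : 0 < (eigenpair b m x).1 + (eigenpair b m x).2 / b x (x + 1) :=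
      add_pos ih.1 (div_pos ((hm 0).trans_le ih.2) (hb x))
    simp only [eigenpair]
    exact ⟨h1, by linarith [ih.2, mul_pos (hm (x + 1)) h1]⟩

theorem eigenpair_fst_le {b : ℕ → ℕ → ℝ} {m : ℕ → ℝ}
    (hb : ∀ x, 0 < b x (x + 1)) (hm : ∀ x, 0 < m x) (x : ℕ) :
    (eigenpair b m (x + 1)).1 ≤
      1 + (∑ r ∈ Finset.range (x + 1), 1 / b r (r + 1)) * (eigenpair b m x).2 := by
  induction x with
  | zero => simp [eigenpair, div_eq_inv_mul]
  | succ x ih =>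
    have hF : (eigenpair b m x).2 ≤ (eigenpair b m (x + 1)).2 := by
      have := mul_pos (hm (x + 1)) (eigenpair_pos hb hm (x + 1)).1
      simp only [eigenpair] at this ⊢
      linarith
    have hS : 0 ≤ ∑ r ∈ Finset.range (x + 1), 1 / b r (r + 1) :=
      Finset.sum_nonneg fun r _ => (one_div_pos.2 (hb r)).le
    have h1 := mul_le_mul_of_nonneg_left hF hS
    have h2 : (eigenpair b m (x + 1 + 1)).1 = (eigenpair b m (x + 1)).1 +
      (eigenpair b m (x + 1)).2 / b (x + 1) (x + 1 + 1) := rfl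
    rw [h2, Finset.sum_range_succ, add_mul, one_div_mul_eq_div]
    linarith

/-- A discrete Grönwall inequality. -/
theorem exists_bound_of_le_one_add_mul {F e : ℕ → ℝ} (hF : ∀ n, 0 ≤ F n) (he : ∀ n, 0 ≤ e n)
    (hs : Summable e) (h : ∀ n, F (n + 1) ≤ F n * (1 + e n)) : ∃ C, ∀ n, F n ≤ C := by
  refine ⟨F 0 * Real.exp (∑' n, e n), fun n => ?_⟩
  have h1 : F n ≤ F 0 * Real.exp (∑ k ∈ Finset.range n, e k) := by
    induction n with
    | zero => simp
    | succ n ih =>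
      rw [Finset.sum_range_succ, Real.exp_add, ← mul_assoc]
      have h2 : 1 + e n ≤ Real.exp (e n) := by linarith [Real.add_one_le_exp (e n)]
      exact (h n).trans (mul_le_mul ih h2 (by linarith [he n])
        (mul_nonneg (hF 0) (Real.exp_pos _).le))
  refine h1.trans (mul_le_mul_of_nonneg_left (Real.exp_le_exp.2 ?_) (hF 0))
  exact hs.sum_le_tsum _ fun k _ => he k

theorem summable_eigenpair {b : ℕ → ℕ → ℝ} {m : ℕ → ℝ}
    (hb : ∀ x, 0 < b x (x + 1)) (hm : ∀ x, 0 < m x)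
    (hs : Summable
      (fun k => (∑ r ∈ Finset.range (k + 1), 1 / b r (r + 1)) ^ 2 * m (k + 1))) :
    Summable (fun x => (eigenpair b m x).1 ^ 2 * m x) := by
  set S : ℕ → ℝ := fun k => ∑ r ∈ Finset.range (k + 1), 1 / b r (r + 1)
  set a : ℝ := b 0 1
  have ha0 : 0 < a := hb 0
  have haS : ∀ k, 1 ≤ a * S k := by
    intro k
    have : 1 / a ≤ S k := Finset.single_le_sum (f := fun r => 1 / b r (r + 1))
      (fun r _ => (one_div_pos.2 (hb r)).le) (by simp)
    rwa [div_le_iff₀' ha0] at this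
  have hS0 : ∀ k, 0 < S k := fun k => pos_of_mul_pos_right (one_pos.trans_le (haS k)) ha0.le
  have hm0 := hm 0
  have hF : ∀ n, 0 ≤ (eigenpair b m n).2 := fun n => hm0.le.trans (eigenpair_pos hb hm n).2
  obtain ⟨C, hC⟩ : ∃ C, ∀ n, (eigenpair b m n).2 ≤ C := by
    refine exists_bound_of_le_one_add_mul (e := fun n => (a ^ 2 / m 0 + a) * (S n ^ 2 * m (n + 1)))
      hF (fun n => ?_) (hs.mul_left _) fun n => ?_
    · have := hm (n + 1)
      positivity
    · have h1 : (eigenpair b m (n + 1)).2 =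
        (eigenpair b m n).2 + m (n + 1) * (eigenpair b m (n + 1)).1 := rfl
      have h2 : (eigenpair b m (n + 1)).1 ≤ 1 + S n * (eigenpair b m n).2 :=
        eigenpair_fst_le hb hm n
      have h3 : 1 ≤ (a * S n) ^ 2 * ((eigenpair b m n).2 / m 0) := by
        refine one_le_mul_of_one_le_of_one_le (one_le_pow₀ (haS n)) ?_
        rw [one_le_div hm0]
        exact (eigenpair_pos hb hm n).2
      have h4 : S n * (eigenpair b m n).2 ≤ (a * S n) * (S n * (eigenpair b m n).2) :=
        le_mul_of_one_le_left (mul_nonneg (hS0 n).le (hF n)) (haS n)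
      have h5 := mul_le_mul_of_nonneg_left (h2.trans (add_le_add h3 h4)) (hm (n + 1)).le
      rw [h1]
      refine (add_le_add le_rfl h5).trans_eq ?_
      ring
  rw [← summable_nat_add_iff 1]
  refine Summable.of_nonneg_of_le (fun k => mul_nonneg (sq_nonneg _) (hm _).le) (fun k => ?_)
    (hs.mul_left ((a + C) ^ 2))
  have h1 : (eigenpair b m (k + 1)).1 ≤ (a + C) * S k := by
    have h2 : (eigenpair b m (k + 1)).1 ≤ 1 + S k * (eigenpair b m k).2 :=
      eigenpair_fst_le hb hm k
    have h3 := mul_le_mul_of_nonneg_left (hC k) (hS0 k).le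
    linarith [haS k]
  have h2 := pow_le_pow_left₀ (eigenpair_pos hb hm (k + 1)).1.le h1 2
  rw [← mul_assoc, ← mul_pow]
  exact mul_le_mul_of_nonneg_right h2 (hm _).le

theorem lap_const_mul {b : ℕ → ℕ → ℝ} {m : ℕ → ℝ} (c : ℝ) (f : ℕ → ℝ) (x : ℕ) :
    lap b m (fun y => c * f y) x = c * lap b m f x := by
  cases x <;> simp only [lap] <;> ring

/-- Hamburger's criterion: on a birth-death chain, the series
`Σ_k (Σ_{r=0}^k 1/b(r,r+1))² m(k+1)` diverges iff for every `λ < 0` the only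
`ℓ²(ℕ,m)` solution of `Δv = λ v` is trivial (i.e. `L_c` is essentially self-adjoint). -/
theorem hamburger_criterion
    (b : ℕ → ℕ → ℝ) (m : ℕ → ℝ)
    (hsymm : ∀ x y, b x y = b y x)
    (hnonneg : ∀ x y, 0 ≤ b x y)
    (hedge : ∀ x y, 0 < b x y ↔ (x = y + 1 ∨ y = x + 1))
    (hm : ∀ x, 0 < m x) :
    (¬ Summable (fun k => (∑ r ∈ Finset.range (k + 1), 1 / b r (r + 1)) ^ 2 * m (k + 1)))
    ↔ (∀ lam : ℝ, lam < 0 → ∀ v : ℕ → ℝ,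
        Summable (fun x => v x ^ 2 * m x) →
        (∀ x, lap b m v x = lam * v x) → v = 0) := by
  have hb : ∀ x, 0 < b x (x + 1) := fun x => (hedge x (x + 1)).2 (Or.inr rfl)
  constructor
  · intro hns lam hlam v hv heq
    have hmul : ∀ c x, lap b m (fun y => c * v y) x = lam * (c * v x) := by
      intro c x
      rw [lap_const_mul, heq x]
      ring
    by_cases h0 : v 0 = 0
    · funext x
      have h1 := (lap_eigenfunction_lower_bound hsymm hb hm hlam heq h0.ge x).1
      have h2 := (lap_eigenfunction_lower_bound hsymm hb hm hlam (hmul (-1))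
        (by simp [h0]) x).1
      simp only [Pi.zero_apply]
      linarith
    · refine absurd ?_ hns
      set c : ℝ := -lam * (m 0 * (v 0 * v 0))
      have hc0 : 0 < c :=
        mul_pos (by linarith) (mul_pos (hm 0) (mul_self_pos.2 h0))
      refine Summable.of_nonneg_of_le (fun k => mul_nonneg (sq_nonneg _) (hm _).le)
        (fun k => ?_) (((summable_nat_add_iff 1).2 hv).mul_left ((v 0 / c) ^ 2))
      have h1 := (lap_eigenfunction_lower_bound hsymm hb hm hlam (hmul (v 0))
        (mul_self_nonneg (v 0)) (k + 1)).2
      have hS : 0 ≤ ∑ r ∈ Finset.range (k + 1), 1 / b r (r + 1) :=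
        Finset.sum_nonneg fun r _ => (one_div_pos.2 (hb r)).le
      have h2 : ∑ r ∈ Finset.range (k + 1), 1 / b r (r + 1) ≤ v 0 / c * v (k + 1) := by
        rw [div_mul_eq_mul_div, le_div_iff₀' hc0]
        exact h1
      rw [← mul_assoc, ← mul_pow]
      exact mul_le_mul_of_nonneg_right (pow_le_pow_left₀ hS h2 2) (hm _).le
  · intro h hs
    have h0 := congrFun (h (-1) (by norm_num) (fun n => (eigenpair b m n).1)
      (summable_eigenpair hb hm hs) (lap_eigenpair hsymm hb hm)) 0
    simp [eigenpair] at h0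
end

section
/- Let (ℕ₀, b, m) be a birth-death chain and let W : ℕ₀ → ℝ satisfy W(x) ≥ K for all x ∈ ℕ₀ for some K ∈ ℝ. If for every λ < 0 the only v ∈ ℓ²(ℕ₀,m) satisfying Δv(x) = λ·v(x) for all x ∈ ℕ₀ is v ≡ 0, then for every λ < K the only v ∈ ℓ²(ℕ₀,m) satisfying Δv(x) + W(x)v(x) = λ·v(x) for all x ∈ ℕ₀ is v ≡ 0. -/
/-- The flux of `f` across the edge `(x, x + 1)`. -/
noncomputable def flux (b : ℕ → ℕ → ℝ) (f : ℕ → ℝ) (x : ℕ) : ℝ :=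
  b x (x + 1) * (f (x + 1) - f x)

/-- `f` solves `Δf + V f = 0`, written as a first-order recursion for the flux. -/
def FluxEq (b : ℕ → ℕ → ℝ) (m V f : ℕ → ℝ) : Prop :=
  flux b f 0 = V 0 * f 0 * m 0 ∧
    ∀ x, flux b f (x + 1) = flux b f x + V (x + 1) * f (x + 1) * m (x + 1)

lemma fluxEq_iff_lap_eq {b : ℕ → ℕ → ℝ} {m : ℕ → ℝ} (hsymm : ∀ x y, b x y = b y x)
    (hm : ∀ x, 0 < m x) (V f : ℕ → ℝ) :
    FluxEq b m V f ↔ ∀ x, lap b m f x = -V x * f x := by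
  have h0 : flux b f 0 = V 0 * f 0 * m 0 ↔ lap b m f 0 = -V 0 * f 0 := by
    rw [lap, flux, one_div, inv_mul_eq_iff_eq_mul₀ (hm 0).ne']
    constructor <;> intro h <;> linarith
  have hs (x : ℕ) : flux b f (x + 1) = flux b f x + V (x + 1) * f (x + 1) * m (x + 1) ↔
      lap b m f (x + 1) = -V (x + 1) * f (x + 1) := by
    rw [lap, flux, flux, one_div, inv_mul_eq_iff_eq_mul₀ (hm (x + 1)).ne', hsymm (x + 1) x]
    constructor <;> intro h <;> linarith
  constructor
  · rintro ⟨h, h'⟩ (_ | x)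
    · exact h0.1 h
    · exact (hs x).1 (h' x)
  · exact fun h => ⟨h0.2 (h 0), fun x => (hs x).2 (h (x + 1))⟩

/-- The value at `x` and the flux across `(x, x + 1)` of the solution of `Δf + V f = 0` with
value `1` at `0`. -/
noncomputable def solutionWithFlux (b : ℕ → ℕ → ℝ) (m V : ℕ → ℝ) : ℕ → ℝ × ℝ
  | 0 => (1, V 0 * m 0)
  | x + 1 =>
    let p := solutionWithFlux b m V x
    let y := p.1 + p.2 / b x (x + 1)
    (y, p.2 + V (x + 1) * y * m (x + 1))

lemma exists_fluxEq {b : ℕ → ℕ → ℝ} (hb : ∀ x, 0 < b x (x + 1)) (m V : ℕ → ℝ) :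
    ∃ f, f 0 = 1 ∧ FluxEq b m V f := by
  have hflux (x : ℕ) : flux b (fun x => (solutionWithFlux b m V x).1) x =
      (solutionWithFlux b m V x).2 := by
    simp only [flux, solutionWithFlux]
    have := (hb x).ne'
    field_simp
    ring
  refine ⟨fun x => (solutionWithFlux b m V x).1, rfl, ?_, fun x => ?_⟩
  · rw [hflux]
    simp [solutionWithFlux]
  · rw [hflux, hflux]
    simp only [solutionWithFlux]

lemma eq_add_flux_div {b : ℕ → ℕ → ℝ} (hb : ∀ x, 0 < b x (x + 1)) (f : ℕ → ℝ) (x : ℕ) :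
    f (x + 1) = f x + flux b f x / b x (x + 1) := by
  rw [flux, mul_div_cancel_left₀ _ (hb x).ne']
  ring

lemma FluxEq.eq_zero {b : ℕ → ℕ → ℝ} {m V f : ℕ → ℝ} (hb : ∀ x, 0 < b x (x + 1))
    (hf : FluxEq b m V f) (h0 : f 0 = 0) : f = 0 := by
  have h (x : ℕ) : f x = 0 ∧ flux b f x = 0 := by
    induction x with
    | zero => exact ⟨h0, by rw [hf.1, h0]; ring⟩
    | succ x ih =>
      have h1 : f (x + 1) = 0 := by rw [eq_add_flux_div hb f, ih.1, ih.2]; simp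
      exact ⟨h1, by rw [hf.2, ih.2, h1]; ring⟩
  exact funext fun x => (h x).1

lemma FluxEq.div_const {b : ℕ → ℕ → ℝ} {m V f : ℕ → ℝ} (hf : FluxEq b m V f) (a : ℝ) :
    FluxEq b m V (fun x => f x / a) := by
  have h (x : ℕ) : flux b (fun x => f x / a) x = flux b f x / a := by
    simp only [flux]
    ring
  refine ⟨?_, fun x => ?_⟩
  · rw [h, hf.1]
    ring
  · rw [h, h, hf.2]
    ring

/-- Comparison principle: a larger nonnegative potential gives a larger solution. -/
lemma FluxEq.nonneg_and_le {b : ℕ → ℕ → ℝ} {m U V f g : ℕ → ℝ} (hb : ∀ x, 0 < b x (x + 1))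
    (hm : ∀ x, 0 < m x) (hU : ∀ x, 0 ≤ U x) (hUV : ∀ x, U x ≤ V x)
    (hf : FluxEq b m U f) (hg : FluxEq b m V g) (hf0 : 0 ≤ f 0) (hfg0 : f 0 ≤ g 0) (x : ℕ) :
    0 ≤ f x ∧ f x ≤ g x := by
  have source (x : ℕ) (h : 0 ≤ f x) (h' : f x ≤ g x) :
      0 ≤ U x * f x * m x ∧ U x * f x * m x ≤ V x * g x * m x :=
    ⟨mul_nonneg (mul_nonneg (hU x) h) (hm x).le,
      mul_le_mul_of_nonneg_right (mul_le_mul (hUV x) h' h ((hU x).trans (hUV x))) (hm x).le⟩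
  suffices h : (0 ≤ f x ∧ f x ≤ g x) ∧ 0 ≤ flux b f x ∧ flux b f x ≤ flux b g x from h.1
  induction x with
  | zero =>
    refine ⟨⟨hf0, hfg0⟩, ?_⟩
    rw [hf.1, hg.1]
    exact source 0 hf0 hfg0
  | succ x ih =>
    obtain ⟨⟨h1, h2⟩, h3, h4⟩ := ih
    have hpos : 0 ≤ f (x + 1) := by
      rw [eq_add_flux_div hb f x]
      exact add_nonneg h1 (div_nonneg h3 (hb x).le)
    have hle : f (x + 1) ≤ g (x + 1) := by
      rw [eq_add_flux_div hb f x, eq_add_flux_div hb g x]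
      exact add_le_add h2 (div_le_div_of_nonneg_right h4 (hb x).le)
    obtain ⟨h5, h6⟩ := source (x + 1) hpos hle
    rw [hf.2, hg.2]
    exact ⟨⟨hpos, hle⟩, add_nonneg h3 h5, add_le_add h4 h6⟩

/-- Adding a potential bounded below by `K` preserves essential self-adjointness:
if for every `λ < 0` the only `ℓ²` solution of `Δv = λ v` is trivial, then for every
`λ < K` the only `ℓ²` solution of `Δv + W v = λ v` is trivial. -/
theorem esa_stable_under_bounded_below_potential
    (b : ℕ → ℕ → ℝ) (m : ℕ → ℝ)
    (hsymm : ∀ x y, b x y = b y x)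
    (hnonneg : ∀ x y, 0 ≤ b x y)
    (hedge : ∀ x y, 0 < b x y ↔ (x = y + 1 ∨ y = x + 1))
    (hm : ∀ x, 0 < m x)
    (W : ℕ → ℝ) (K : ℝ) (hW : ∀ x, K ≤ W x)
    (hLap : ∀ lam : ℝ, lam < 0 → ∀ v : ℕ → ℝ,
      Summable (fun x => v x ^ 2 * m x) →
      (∀ x, lap b m v x = lam * v x) → v = 0) :
    ∀ lam : ℝ, lam < K → ∀ v : ℕ → ℝ,
      Summable (fun x => v x ^ 2 * m x) →
      (∀ x, lap b m v x + W x * v x = lam * v x) → v = 0 := by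
  intro lam hlam v hv heq
  have hb (x : ℕ) : 0 < b x (x + 1) := (hedge x (x + 1)).2 (Or.inr rfl)
  have hvflux : FluxEq b m (fun x => W x - lam) v :=
    (fluxEq_iff_lap_eq hsymm hm _ v).2 fun x => by linarith [heq x]
  by_contra hne
  have hv0 : v 0 ≠ 0 := fun h => hne (hvflux.eq_zero hb h)
  obtain ⟨w, hw0, hw⟩ := exists_fluxEq hb m (fun _ => K - lam)
  have hle := hw.nonneg_and_le hb hm (fun _ => by linarith) (fun x => by linarith [hW x])
    (hvflux.div_const (v 0)) (by simp [hw0]) (by simp [hw0, hv0])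
  have hsum : Summable fun x => w x ^ 2 * m x := by
    refine (hv.mul_left (1 / v 0 ^ 2)).of_nonneg_of_le
      (fun x => mul_nonneg (sq_nonneg _) (hm x).le) fun x => ?_
    calc w x ^ 2 * m x ≤ (v x / v 0) ^ 2 * m x :=
          mul_le_mul_of_nonneg_right (pow_le_pow_left₀ (hle x).1 (hle x).2 2) (hm x).le
      _ = 1 / v 0 ^ 2 * (v x ^ 2 * m x) := by ring
  have hwzero := hLap (lam - K) (by linarith) w hsum fun x => by
    rw [(fluxEq_iff_lap_eq hsymm hm _ w).1 hw x, neg_sub]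
  simp [hwzero] at hw0
end

section
/- Let (ℕ₀, b, m) be a birth-death chain, W : ℕ₀ → ℝ a potential and λ ∈ ℝ. For i ≥ 0 set α_i = (W(i+1)−λ)·m(i+1)/b(i+1,i+2) and β_i = b(i,i+1)/b(i+1,i+2). If v : ℕ₀ → ℝ satisfies Δv(r) + W(r)v(r) − λ·v(r) = 0 for all r ≥ 1, then for all k ≥ 2: v(k)² ≤ (∏_{i=0}^{k−2} [(1 + α_i + β_i)² + β_i² + 1]) · (v(1)² + v(0)²). -/
/-- The three-term recursion satisfied by solutions of the eigenvalue equation. -/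
lemma eigen_recursion {b : ℕ → ℕ → ℝ} {m W v : ℕ → ℝ} {lam : ℝ} {i : ℕ}
    (hsymm : b (i + 1) i = b i (i + 1)) (hb : b (i + 1) (i + 2) ≠ 0) (hm : m (i + 1) ≠ 0)
    (heig : lap b m v (i + 1) + W (i + 1) * v (i + 1) - lam * v (i + 1) = 0) :
    v (i + 2) =
      (1 + (W (i + 1) - lam) * m (i + 1) / b (i + 1) (i + 2)
          + b i (i + 1) / b (i + 1) (i + 2)) * v (i + 1)
        - b i (i + 1) / b (i + 1) (i + 2) * v i := by
  simp only [lap, hsymm] at heig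
  field_simp at heig ⊢
  linarith

/-- One step of a recursion with transfer matrix `!![a, -c; 1, 0]` increases the squared norm
by at most the trace of the Gram matrix. -/
lemma sq_add_sq_transfer_le (a c x y : ℝ) :
    (a * x - c * y) ^ 2 + x ^ 2 ≤ (a ^ 2 + c ^ 2 + 1) * (x ^ 2 + y ^ 2) := by
  nlinarith [sq_nonneg (a * y + c * x), sq_nonneg y]

/-- Iterating the transfer matrix bound along a second-order recursion. -/
lemma sq_add_sq_le_prod_of_recursion {a c v : ℕ → ℝ}
    (hv : ∀ i, v (i + 2) = a i * v (i + 1) - c i * v i) (n : ℕ) :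
    v (n + 1) ^ 2 + v n ^ 2 ≤
      (∏ i ∈ Finset.range n, (a i ^ 2 + c i ^ 2 + 1)) * (v 1 ^ 2 + v 0 ^ 2) := by
  induction n with
  | zero => simp
  | succ n ih =>
    rw [Finset.prod_range_succ, hv n, mul_comm (∏ i ∈ _, _), mul_assoc]
    exact (sq_add_sq_transfer_le _ _ _ _).trans (mul_le_mul_of_nonneg_left ih (by positivity))

/-- Pointwise growth bound for solutions of the eigenvalue equation: with
`α_i = (W(i+1)−λ)m(i+1)/b(i+1,i+2)` and `β_i = b(i,i+1)/b(i+1,i+2)`, for `k ≥ 2`,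
`v(k)² ≤ (∏_{i=0}^{k−2} ((1+α_i+β_i)² + β_i² + 1)) (v(1)² + v(0)²)`. -/
theorem solution_growth_bound
    (b : ℕ → ℕ → ℝ) (m : ℕ → ℝ)
    (hsymm : ∀ x y, b x y = b y x)
    (hnonneg : ∀ x y, 0 ≤ b x y)
    (hedge : ∀ x y, 0 < b x y ↔ (x = y + 1 ∨ y = x + 1))
    (hm : ∀ x, 0 < m x)
    (W : ℕ → ℝ) (lam : ℝ) (v : ℕ → ℝ)
    (heig : ∀ r, 1 ≤ r → lap b m v r + W r * v r - lam * v r = 0) :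
    ∀ k, 2 ≤ k →
      v k ^ 2 ≤
        (∏ i ∈ Finset.range (k - 1),
          ((1 + (W (i + 1) - lam) * m (i + 1) / b (i + 1) (i + 2)
              + b i (i + 1) / b (i + 1) (i + 2)) ^ 2
            + (b i (i + 1) / b (i + 1) (i + 2)) ^ 2 + 1))
          * (v 1 ^ 2 + v 0 ^ 2) := by
  intro k hk
  obtain ⟨n, rfl⟩ : ∃ n, k = n + 1 := ⟨k - 1, by omega⟩
  have hv (i : ℕ) := eigen_recursion (hsymm (i + 1) i)
    ((hedge (i + 1) (i + 2)).2 (Or.inr rfl)).ne' (hm (i + 1)).ne' (heig (i + 1) (by omega))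
  exact (le_add_of_nonneg_right (sq_nonneg (v n))).trans (sq_add_sq_le_prod_of_recursion hv n)
end

section
/- Let (ℕ₀, b, m) be a birth-death chain and W : ℕ₀ → ℝ be such that L_c + W is semi-bounded with lower bound K, and let λ < K. If Σ_{k=0}^∞ (∏_{i=0}^{k} [ (1 + (b(i,i+1) + (W(i+1)−λ)·m(i+1))/b(i+1,i+2))² + (b(i,i+1)/b(i+1,i+2))² + 1 ]) · m(k+2) < ∞, then there exists a function v ∈ ℓ²(ℕ₀,m), not identically zero, satisfying Δv(x) + W(x)v(x) − λ·v(x) = 0 for all x ∈ ℕ₀ (so L_c + W is not essentially self-adjoint). -/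
/-- `L_c + W` is semi-bounded with lower bound `K`. -/
noncomputable def SemiboundedBelow (b : ℕ → ℕ → ℝ) (m W : ℕ → ℝ) (K : ℝ) : Prop :=
  ∀ φ : ℕ → ℝ, (Function.support φ).Finite →
    K * ∑' x, φ x ^ 2 * m x ≤ ∑' x, (lap b m φ x + W x * φ x) * φ x * m x

/-- The solution of the three-term recursion `v (k + 2) = p k * v (k + 1) - q k * v k` with
initial values `v 0 = 1` and `v 1 = a`. -/
def threeTermRec (a : ℝ) (p q : ℕ → ℝ) : ℕ → ℝ
  | 0 => 1
  | 1 => a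
  | k + 2 => p k * threeTermRec a p q (k + 1) - q k * threeTermRec a p q k

lemma sq_sub_le_mul_add (p q x y : ℝ) :
    (p * x - q * y) ^ 2 ≤ (p ^ 2 + q ^ 2) * (x ^ 2 + y ^ 2) := by
  nlinarith [sq_nonneg (p * y + q * x)]

lemma threeTermRec_sq_add_sq_le (a : ℝ) (p q : ℕ → ℝ) (k : ℕ) :
    threeTermRec a p q (k + 1) ^ 2 + threeTermRec a p q k ^ 2 ≤
      (∏ i ∈ Finset.range k, (p i ^ 2 + q i ^ 2 + 1)) * (a ^ 2 + 1) := by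
  induction k with
  | zero => simp [threeTermRec]
  | succ k ih =>
    rw [Finset.prod_range_succ, threeTermRec]
    have h := sq_sub_le_mul_add (p k) (q k) (threeTermRec a p q (k + 1)) (threeTermRec a p q k)
    have h' := mul_le_mul_of_nonneg_left ih (by positivity : 0 ≤ p k ^ 2 + q k ^ 2 + 1)
    nlinarith [sq_nonneg (threeTermRec a p q k)]

lemma threeTermRec_add_two_sq_le (a : ℝ) (p q : ℕ → ℝ) (k : ℕ) :
    threeTermRec a p q (k + 2) ^ 2 ≤
      (∏ i ∈ Finset.range (k + 1), (p i ^ 2 + q i ^ 2 + 1)) * (a ^ 2 + 1) :=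
  (le_add_of_nonneg_right (sq_nonneg _)).trans (threeTermRec_sq_add_sq_le a p q (k + 1))

/-- Failure of essential self-adjointness: if the series
`Σ_k (∏_{i=0}^{k} [(1 + (b(i,i+1)+(W(i+1)−λ)m(i+1))/b(i+1,i+2))² + (b(i,i+1)/b(i+1,i+2))² + 1]) m(k+2)`
converges for some `λ < K`, then there is a nontrivial `ℓ²(ℕ,m)` solution of
`(Δ + W − λ)v = 0`, so `L_c + W` is not essentially self-adjoint. -/
theorem failure_of_esa
    (b : ℕ → ℕ → ℝ) (m : ℕ → ℝ)
    (hsymm : ∀ x y, b x y = b y x)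
    (hnonneg : ∀ x y, 0 ≤ b x y)
    (hedge : ∀ x y, 0 < b x y ↔ (x = y + 1 ∨ y = x + 1))
    (hm : ∀ x, 0 < m x)
    (W : ℕ → ℝ) (K : ℝ) (hsb : SemiboundedBelow b m W K)
    (lam : ℝ) (hlam : lam < K)
    (hsum : Summable (fun k =>
      (∏ i ∈ Finset.range (k + 1),
        ((1 + (b i (i + 1) + (W (i + 1) - lam) * m (i + 1)) / b (i + 1) (i + 2)) ^ 2
          + (b i (i + 1) / b (i + 1) (i + 2)) ^ 2 + 1))
        * m (k + 2))) :
    ∃ v : ℕ → ℝ, Summable (fun x => v x ^ 2 * m x) ∧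
      (∀ x, lap b m v x + W x * v x - lam * v x = 0) ∧ v ≠ 0 := by
  have hpos : ∀ x, 0 < b x (x + 1) := fun x => (hedge x (x + 1)).2 (Or.inr rfl)
  refine ⟨threeTermRec (1 + (W 0 - lam) * m 0 / b 0 1)
    (fun i => 1 + (b i (i + 1) + (W (i + 1) - lam) * m (i + 1)) / b (i + 1) (i + 2))
    (fun i => b i (i + 1) / b (i + 1) (i + 2)), ?_, ?_, ?_⟩
  · rw [← summable_nat_add_iff 2]
    refine Summable.of_nonneg_of_le (fun k => mul_nonneg (sq_nonneg _) (hm _).le) (fun k => ?_)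
      (hsum.mul_right ((1 + (W 0 - lam) * m 0 / b 0 1) ^ 2 + 1))
    rw [mul_right_comm]
    exact mul_le_mul_of_nonneg_right (threeTermRec_add_two_sq_le _ _ _ k) (hm _).le
  · rintro (_ | x)
    · have h0 := (hm 0).ne'
      have h1 := (hpos 0).ne'
      simp only [zero_add] at h1
      simp only [lap, threeTermRec]
      field_simp
      ring
    · have h0 := (hm (x + 1)).ne'
      have h1 : b (x + 1) (x + 2) ≠ 0 := (hpos (x + 1)).ne'
      simp only [lap, threeTermRec, hsymm (x + 1) x]
      field_simp
      ring
  · intro h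
    simpa [threeTermRec] using congrFun h 0
end
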